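/- Let d ≥ 2 and γ ≥ 1. There exists a constant C > 0, depending only on d and γ, such that for every ε ∈ (0,1) and every r > 0, the probability under the grand canonical hard-sphere Gibbs measure that the configuration contains γ+1 distinct particles whose r-proximity graph is connected (i.e., the graph on these γ+1 particles with an edge between two of them whenever the torus distance of their positions is at most r is connected) is at most C · μ_ε^{γ+1} · r^{dγ}, where μ_ε = ε^{−(d−1)}. -/

import Mathlib

open MeasureTheory Real
open scoped ENNReal BigOperators Classical

noncomputable section

/-- The unit `d`-dimensional torus `𝕋^d = ℝ^d/ℤ^d`, as a product of unit circles.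
It carries its Haar probability measure. -/
abbrev Torus (d : ℕ) := Fin d → AddCircle (1 : ℝ)

/-- The Euclidean quotient distance on the torus `𝕋^d`. -/
noncomputable def torusDist {d : ℕ} (x y : Torus d) : ℝ :=
  Real.sqrt (∑ i, dist (x i) (y i) ^ 2)

/-- The one-particle phase space `𝔻 = 𝕋^d × ℝ^d`. -/
abbrev Phase (d : ℕ) := Torus d × EuclideanSpace ℝ (Fin d)

/-- The standard Maxwellian `M(v) = (2π)^{−d/2} exp(−|v|²/2)`. -/
noncomputable def maxwellian (d : ℕ) (v : EuclideanSpace ℝ (Fin d)) : ℝ :=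
  (2 * π) ^ (-(d : ℝ) / 2) * Real.exp (-‖v‖ ^ 2 / 2)

/-- The Boltzmann-Grad density `μ_ε = ε^{−(d−1)}`. -/
noncomputable def mu (d : ℕ) (ε : ℝ) : ℝ := ε ^ (-((d : ℤ) - 1))

/-- The hard-core exclusion: `Z_N ∈ D^ε_N` iff all mutual torus distances of the
positions exceed `ε`. -/
def HardCore (d : ℕ) (ε : ℝ) {N : ℕ} (Z : Fin N → Phase d) : Prop :=
  ∀ i j, i ≠ j → ε < torusDist (Z i).1 (Z j).1

/-- The density `1_{D^ε_N}(Z_N) M^{⊗N}(V_N)` of the hard-sphere Gibbs weight. -/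
noncomputable def hsWeight (d : ℕ) (ε : ℝ) {N : ℕ} (Z : Fin N → Phase d) : ℝ :=
  (if HardCore d ε Z then 1 else 0) * ∏ i, maxwellian d (Z i).2

/-- The grand canonical partition function
`Z^ε = 1 + ∑_{N≥1} (μ_ε^N/N!) ∫ 1_{D^ε_N} M^{⊗N} dZ_N` (the `N = 0` term of the
series equals `1`). -/
noncomputable def partitionFn (d : ℕ) (ε : ℝ) : ℝ :=
  ∑' N : ℕ, mu d ε ^ N / N.factorial * ∫ Z : Fin N → Phase d, hsWeight d ε Z

instance sigmaFinite_volume_phase (d : ℕ) : SigmaFinite (volume : Measure (Phase d)) :=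
  inferInstanceAs (SigmaFinite ((volume : Measure (Torus d)).prod
    (volume : Measure (EuclideanSpace ℝ (Fin d)))))

theorem lintegral_fin_prod_eq_pow {α : Type*} [MeasureSpace α]
    [SigmaFinite (volume : Measure α)] {g : α → ℝ≥0∞} (hg : Measurable g) (n : ℕ) :
    ∫⁻ X : Fin n → α, ∏ i, g (X i) = (∫⁻ x, g x) ^ n := by
  induction n with
  | zero => simp [volume_pi]
  | succ n ih =>
    rw [(volume_preserving_piFinSuccAbove (fun _ : Fin (n + 1) => α) 0).symm.lintegral_map_equiv]
    simp only [MeasurableEquiv.piFinSuccAbove_symm_apply, Fin.insertNthEquiv,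
      Fin.prod_univ_succ, Fin.insertNth_zero, Equiv.coe_fn_mk, Fin.cons_succ,
      Fin.zero_succAbove, cast_eq, Fin.cons_zero]
    rw [Measure.volume_eq_prod]
    rw [lintegral_prod_mul (f := g) (g := fun Y : Fin n → α => ∏ i, g (Y i)) hg.aemeasurable
      (Finset.measurable_prod _ fun i _ => hg.comp (measurable_pi_apply i)).aemeasurable,
      ih, pow_succ']

theorem lintegral_mul_prod_le {α : Type*} [MeasureSpace α] [SigmaFinite (volume : Measure α)]
    {g : α → ℝ≥0∞} (hg : Measurable g) {F : α → α → ℝ≥0∞}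
    (hF : Measurable fun q : α × α => F q.1 q.2) {B : ℝ≥0∞} (hB : ∀ z, ∫⁻ y, F z y ≤ B) (n : ℕ) :
    ∫⁻ q : α × (Fin n → α), g q.1 * ∏ a, F q.1 (q.2 a) ≤ (∫⁻ z, g z) * B ^ n := by
  have hprod : Measurable fun q : α × (Fin n → α) => g q.1 * ∏ a, F q.1 (q.2 a) := by
    refine Measurable.mul (hg.comp measurable_fst) (Finset.measurable_prod _ fun a _ => ?_)
    have ha : Measurable fun q : α × (Fin n → α) => (q.1, q.2 a) :=
      measurable_fst.prodMk ((measurable_pi_apply a).comp measurable_snd)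
    exact hF.comp ha
  rw [Measure.volume_eq_prod, lintegral_prod _ hprod.aemeasurable, ← lintegral_mul_const _ hg]
  refine lintegral_mono fun z => ?_
  have hz : Measurable (F z) := hF.comp measurable_prodMk_left
  have hzprod : Measurable fun Y : Fin n → α => ∏ a, F z (Y a) :=
    Finset.measurable_prod _ fun a _ => hz.comp (measurable_pi_apply a)
  dsimp only
  rw [lintegral_const_mul _ hzprod, lintegral_fin_prod_eq_pow hz]
  gcongr
  exact hB z

theorem torusDist_eq_dist {d : ℕ} (x y : Torus d) :
    torusDist x y = dist (WithLp.toLp 2 x) (WithLp.toLp 2 y) := by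
  rw [PiLp.dist_eq_of_L2]
  rfl

theorem torusDist_self {d : ℕ} (x : Torus d) : torusDist x x = 0 := by
  simp [torusDist_eq_dist]

theorem torusDist_comm {d : ℕ} (x y : Torus d) : torusDist x y = torusDist y x := by
  simp only [torusDist_eq_dist, dist_comm]

theorem torusDist_triangle {d : ℕ} (x y z : Torus d) :
    torusDist x z ≤ torusDist x y + torusDist y z := by
  simp only [torusDist_eq_dist]
  exact dist_triangle _ _ _

theorem measurable_torusDist {d : ℕ} {α : Type*} [MeasurableSpace α] {f g : α → Torus d}
    (hf : Measurable f) (hg : Measurable g) : Measurable fun a => torusDist (f a) (g a) := by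
  unfold torusDist
  refine Measurable.sqrt (Finset.measurable_sum _ fun i _ => Measurable.pow_const ?_ 2)
  exact Measurable.dist (measurable_pi_iff.1 hf i) (measurable_pi_iff.1 hg i)

/-- Along a walk in a proximity graph the distance is at most the length times the radius. -/
theorem torusDist_le_of_walk {d : ℕ} {V : Type*} (x : V → Torus d) (r : ℝ) {a b : V}
    (p : (SimpleGraph.fromRel fun a b => torusDist (x a) (x b) ≤ r).Walk a b) :
    torusDist (x a) (x b) ≤ p.length * r := by
  induction p with
  | nil => simp [torusDist_self]
  | @cons u v w h p ih =>
    have hr : torusDist (x u) (x v) ≤ r := by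
      rcases ((SimpleGraph.fromRel_adj _ _ _).1 h).2 with h | h
      · exact h
      · rwa [torusDist_comm]
    have := torusDist_triangle (x u) (x v) (x w)
    rw [SimpleGraph.Walk.length_cons]
    push_cast
    linarith

theorem torusDist_le_of_connected {d γ : ℕ} (x : Fin (γ + 1) → Torus d) {r : ℝ} (hr : 0 ≤ r)
    (h : (SimpleGraph.fromRel fun a b => torusDist (x a) (x b) ≤ r).Connected)
    (a b : Fin (γ + 1)) : torusDist (x a) (x b) ≤ γ * r := by
  obtain ⟨p, hp⟩ := (h.preconnected a b).exists_isPath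
  have hlen : p.length ≤ γ := by
    have := hp.length_lt
    rw [Fintype.card_fin] at this
    omega
  refine (torusDist_le_of_walk x r p).trans ?_
  gcongr

theorem volume_torusDist_le {d : ℕ} (x : Torus d) {ρ : ℝ} (hρ : 0 ≤ ρ) :
    volume {y : Torus d | torusDist y x ≤ ρ} ≤ ENNReal.ofReal ((2 * ρ) ^ d) := by
  have hsub : {y : Torus d | torusDist y x ≤ ρ} ⊆
      Set.univ.pi fun i => Metric.closedBall (x i) ρ := by
    intro y hy i _
    rw [Metric.mem_closedBall]
    refine le_trans ?_ (show torusDist y x ≤ ρ from hy)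
    refine Real.le_sqrt_of_sq_le ?_
    exact Finset.single_le_sum (f := fun j => dist (y j) (x j) ^ 2)
      (fun _ _ => sq_nonneg _) (Finset.mem_univ i)
  refine (measure_mono hsub).trans ?_
  rw [volume_pi_pi, ENNReal.ofReal_pow (by positivity)]
  calc ∏ i, volume (Metric.closedBall (x i) ρ)
      ≤ ∏ _i : Fin d, ENNReal.ofReal (2 * ρ) := by
        gcongr with i
        rw [AddCircle.volume_closedBall]
        exact ENNReal.ofReal_le_ofReal (min_le_right _ _)
    _ = _ := by simp

theorem maxwellian_nonneg (d : ℕ) (v : EuclideanSpace ℝ (Fin d)) : 0 ≤ maxwellian d v := by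
  unfold maxwellian
  positivity

theorem continuous_maxwellian (d : ℕ) : Continuous (maxwellian d) := by
  unfold maxwellian
  fun_prop

theorem integral_maxwellian (d : ℕ) : ∫ v, maxwellian d v = 1 := by
  have h := GaussianFourier.integral_rexp_neg_mul_sq_norm (V := EuclideanSpace ℝ (Fin d))
    (b := 1 / 2) (by norm_num)
  have h2 : ∀ v : EuclideanSpace ℝ (Fin d), maxwellian d v =
      (2 * π) ^ (-(d : ℝ) / 2) * Real.exp (-(1 / 2) * ‖v‖ ^ 2) := by
    intro v
    unfold maxwellian
    congr 2
    ring
  simp_rw [h2]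
  rw [integral_const_mul, h, finrank_euclideanSpace_fin, show π / (1 / 2) = 2 * π by ring,
    ← Real.rpow_add (by positivity)]
  ring_nf
  exact Real.rpow_zero _

/-- The Maxwellian as an extended nonnegative weight on the one-particle phase space. -/
def phaseWeight (d : ℕ) (z : Phase d) : ℝ≥0∞ := ENNReal.ofReal (maxwellian d z.2)

@[fun_prop]
theorem measurable_phaseWeight (d : ℕ) : Measurable (phaseWeight d) :=
  ((continuous_maxwellian d).comp continuous_snd).measurable.ennreal_ofReal

theorem ofReal_prod_maxwellian (d : ℕ) {ι : Type*} [Fintype ι] (Z : ι → Phase d) :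
    ENNReal.ofReal (∏ i, maxwellian d (Z i).2) = ∏ i, phaseWeight d (Z i) :=
  ENNReal.ofReal_prod_of_nonneg fun _ _ => maxwellian_nonneg _ _

theorem lintegral_maxwellian (d : ℕ) : ∫⁻ v, ENNReal.ofReal (maxwellian d v) = 1 := by
  have hint : Integrable (maxwellian d) := by
    by_contra h
    have := integral_undef h
    rw [integral_maxwellian] at this
    exact one_ne_zero this
  rw [← ofReal_integral_eq_lintegral_ofReal hint (ae_of_all _ (maxwellian_nonneg d)),
    integral_maxwellian, ENNReal.ofReal_one]

theorem lintegral_indicator_mul_phaseWeight {d : ℕ} {p : Torus d → Prop}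
    (hp : MeasurableSet {x | p x}) :
    ∫⁻ z : Phase d, (if p z.1 then (1 : ℝ≥0∞) else 0) * phaseWeight d z = volume {x | p x} := by
  unfold phaseWeight
  rw [Measure.volume_eq_prod, lintegral_prod_mul (f := fun x => if p x then (1 : ℝ≥0∞) else 0)
    (g := fun v => ENNReal.ofReal (maxwellian d v))
    (Measurable.ite hp measurable_const measurable_const).aemeasurable
    (continuous_maxwellian d).measurable.ennreal_ofReal.aemeasurable,
    lintegral_maxwellian, mul_one, ← lintegral_indicator_one hp]
  simp [Set.indicator_apply]

theorem lintegral_phaseWeight (d : ℕ) : ∫⁻ z : Phase d, phaseWeight d z = 1 := by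
  have h := lintegral_indicator_mul_phaseWeight (d := d) (p := fun _ => True) (by simp)
  simp only [if_true, one_mul] at h
  rw [h, volume_pi]
  simp [Measure.pi_univ]

/-- The total weight of the configurations of `γ + 1` particles that are all within `ρ` of the
first one is at most `(2ρ)^{dγ}`. -/
theorem lintegral_near_zero_le {d : ℕ} (γ : ℕ) {ρ : ℝ} (hρ : 0 ≤ ρ) :
    ∫⁻ X : Fin (γ + 1) → Phase d,
        (if ∀ a, torusDist (X a).1 (X 0).1 ≤ ρ then (1 : ℝ≥0∞) else 0) *
          ∏ a, phaseWeight d (X a) ≤ ENNReal.ofReal ((2 * ρ) ^ (d * γ)) := by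
  set F : Phase d → Phase d → ℝ≥0∞ := fun z y =>
    (if torusDist y.1 z.1 ≤ ρ then (1 : ℝ≥0∞) else 0) * phaseWeight d y with hF
  have hFm : Measurable fun q : Phase d × Phase d => F q.1 q.2 := by
    refine Measurable.mul ?_ ((measurable_phaseWeight d).comp measurable_snd)
    exact Measurable.ite (measurableSet_le (measurable_torusDist (by fun_prop) (by fun_prop))
      measurable_const) measurable_const measurable_const
  have hball (z : Phase d) : ∫⁻ y, F z y ≤ ENNReal.ofReal ((2 * ρ) ^ d) := by
    rw [hF, lintegral_indicator_mul_phaseWeight (p := fun x => torusDist x z.1 ≤ ρ)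
      (measurableSet_le (measurable_torusDist measurable_id measurable_const) measurable_const)]
    exact volume_torusDist_le _ hρ
  rw [MeasurePreserving.lintegral_map_equiv _ _
    (volume_preserving_piFinSuccAbove (fun _ : Fin (γ + 1) => Phase d) 0).symm]
  calc _ ≤ ∫⁻ q : Phase d × (Fin γ → Phase d), phaseWeight d q.1 * ∏ a, F q.1 (q.2 a) := by
        refine lintegral_mono fun q => ?_
        simp only [MeasurableEquiv.piFinSuccAbove_symm_apply, Fin.insertNthEquiv,
          Fin.prod_univ_succ, Fin.insertNth_zero, Equiv.coe_fn_mk, Fin.cons_succ,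
          Fin.zero_succAbove, cast_eq, Fin.cons_zero, Fin.forall_fin_succ]
        split_ifs with h
        · have : ∀ a, F q.1 (q.2 a) = phaseWeight d (q.2 a) := fun a => by
            simp only [hF, if_pos (h.2 a), one_mul]
          simp [this]
        · simp
    _ ≤ (∫⁻ z, phaseWeight d z) * ENNReal.ofReal ((2 * ρ) ^ d) ^ γ :=
        lintegral_mul_prod_le (measurable_phaseWeight d) hFm hball γ
    _ = _ := by
        rw [lintegral_phaseWeight, one_mul, ← ENNReal.ofReal_pow (by positivity), pow_mul]

/-- The unnormalised mass `∫ 1_{D^ε_N} M^{⊗N} dZ_N` of the `N`-particle sector. -/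
def hsMass (d : ℕ) (ε : ℝ) (N : ℕ) : ℝ≥0∞ :=
  ∫⁻ Z : Fin N → Phase d, (if HardCore d ε Z then (1 : ℝ≥0∞) else 0) * ∏ i, phaseWeight d (Z i)

theorem measurableSet_hardCore (d : ℕ) (ε : ℝ) (N : ℕ) :
    MeasurableSet {Z : Fin N → Phase d | HardCore d ε Z} := by
  unfold HardCore
  simp only [Set.ofPred_forall]
  refine .iInter fun i => .iInter fun j => .iInter fun _ => ?_
  exact measurableSet_lt measurable_const (measurable_torusDist (by fun_prop) (by fun_prop))

@[fun_prop]
theorem measurable_hardCore_indicator (d : ℕ) (ε : ℝ) (N : ℕ) :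
    Measurable fun Z : Fin N → Phase d => if HardCore d ε Z then (1 : ℝ≥0∞) else 0 :=
  Measurable.ite (measurableSet_hardCore d ε N) measurable_const measurable_const

@[fun_prop]
theorem measurable_near_zero_indicator (d γ : ℕ) (ρ : ℝ) :
    Measurable fun X : Fin (γ + 1) → Phase d =>
      if ∀ a, torusDist (X a).1 (X 0).1 ≤ ρ then (1 : ℝ≥0∞) else 0 := by
  refine Measurable.ite ?_ measurable_const measurable_const
  simp only [Set.ofPred_forall]
  refine .iInter fun i => ?_
  exact measurableSet_le (measurable_torusDist (by fun_prop) (by fun_prop)) measurable_const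

theorem hsMass_le_one (d : ℕ) (ε : ℝ) (N : ℕ) : hsMass d ε N ≤ 1 := by
  calc hsMass d ε N ≤ ∫⁻ Z : Fin N → Phase d, ∏ i, phaseWeight d (Z i) := by
        refine lintegral_mono fun Z => ?_
        dsimp only
        split_ifs <;> simp
    _ = 1 := by
        rw [lintegral_fin_prod_eq_pow (measurable_phaseWeight d), lintegral_phaseWeight, one_pow]

theorem integral_hsWeight (d : ℕ) (ε : ℝ) (N : ℕ) :
    ∫ Z : Fin N → Phase d, hsWeight d ε Z = (hsMass d ε N).toReal := by
  rw [integral_eq_lintegral_of_nonneg_ae]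
  · congr 1
    refine lintegral_congr fun Z => ?_
    rw [← ofReal_prod_maxwellian, hsWeight]
    split_ifs <;> simp
  · refine ae_of_all _ fun Z => ?_
    have := Finset.prod_nonneg fun i (_ : i ∈ Finset.univ) => maxwellian_nonneg d (Z i).2
    unfold hsWeight
    simp only [Pi.zero_apply]
    split_ifs <;> simp [this]
  · refine Measurable.aestronglyMeasurable ?_
    unfold hsWeight
    refine Measurable.mul (Measurable.ite (measurableSet_hardCore d ε N) measurable_const
      measurable_const) (Finset.measurable_prod _ fun i _ => ?_)
    exact (continuous_maxwellian d).measurable.comp (by fun_prop)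

theorem mu_pos (d : ℕ) {ε : ℝ} (hε : 0 < ε) : 0 < mu d ε := zpow_pos hε _

theorem ofReal_partitionFn (d : ℕ) {ε : ℝ} (hε : 0 < ε) :
    ENNReal.ofReal (partitionFn d ε) =
      ∑' N : ℕ, ENNReal.ofReal (mu d ε ^ N / N.factorial) * hsMass d ε N := by
  have hmu := mu_pos d hε
  have hle (N : ℕ) : (hsMass d ε N).toReal ≤ 1 :=
    ENNReal.toReal_le_of_le_ofReal zero_le_one (by simpa using hsMass_le_one d ε N)
  unfold partitionFn
  simp_rw [integral_hsWeight]
  rw [ENNReal.ofReal_tsum_of_nonneg (fun N => by positivity)]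
  · refine tsum_congr fun N => ?_
    rw [ENNReal.ofReal_mul (by positivity), ENNReal.ofReal_toReal]
    exact ne_top_of_le_ne_top ENNReal.one_ne_top (hsMass_le_one d ε N)
  · refine Summable.of_nonneg_of_le (fun N => by positivity) (fun N => ?_)
      (Real.summable_pow_div_factorial (mu d ε))
    exact mul_le_of_le_one_right (by positivity) (hle N)

/-- Every embedding of `Fin k` into `Fin (m + k)` extends to a relabelling of the whole set. -/
theorem exists_equiv_extending {k m : ℕ} (f : Fin k ↪ Fin (m + k)) :
    ∃ e : Fin k ⊕ Fin m ≃ Fin (m + k), ∀ a, e (Sum.inl a) = f a := by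
  have hcard : Fintype.card ↥(Set.range f)ᶜ = m := by
    rw [Fintype.card_compl_set, Fintype.card_range, Fintype.card_fin, Fintype.card_fin]
    omega
  exact ⟨(Equiv.sumCongr (Equiv.ofInjective f f.injective)
    (Fintype.equivFinOfCardEq hcard).symm).trans (Equiv.Set.sumCompl (Set.range f)), fun a => by simp⟩

/-- Forgetting the hard-core constraint on the selected particles decouples them from the rest. -/
theorem lintegral_near_selected_le {d γ m : ℕ} (ε : ℝ) {ρ : ℝ} (hρ : 0 ≤ ρ)
    (f : Fin (γ + 1) ↪ Fin (m + (γ + 1))) :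
    ∫⁻ Z : Fin (m + (γ + 1)) → Phase d,
        (if HardCore d ε Z then (1 : ℝ≥0∞) else 0) *
          (if ∀ a, torusDist (Z (f a)).1 (Z (f 0)).1 ≤ ρ then (1 : ℝ≥0∞) else 0) *
          ∏ i, phaseWeight d (Z i) ≤ ENNReal.ofReal ((2 * ρ) ^ (d * γ)) * hsMass d ε m := by
  obtain ⟨e, he⟩ := exists_equiv_extending f
  rw [MeasurePreserving.lintegral_map_equiv _ _
      (volume_measurePreserving_piCongrLeft (fun _ => Phase d) e),
    MeasurePreserving.lintegral_map_equiv _ _ (volume_measurePreserving_sumPiEquivProdPi_symm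
      (fun _ : Fin (γ + 1) ⊕ Fin m => Phase d))]
  set G : (Fin (γ + 1) → Phase d) → ℝ≥0∞ := fun X =>
    (if ∀ a, torusDist (X a).1 (X 0).1 ≤ ρ then (1 : ℝ≥0∞) else 0) * ∏ a, phaseWeight d (X a)
  set H : (Fin m → Phase d) → ℝ≥0∞ := fun Y =>
    (if HardCore d ε Y then (1 : ℝ≥0∞) else 0) * ∏ i, phaseWeight d (Y i)
  have hG : Measurable G := by fun_prop
  have hH : Measurable H := by fun_prop
  calc _ ≤ ∫⁻ q : (Fin (γ + 1) → Phase d) × (Fin m → Phase d), G q.1 * H q.2 := by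
        refine lintegral_mono fun q => ?_
        set Z := MeasurableEquiv.piCongrLeft (fun _ => Phase d) e
          ((MeasurableEquiv.sumPiEquivProdPi fun _ : Fin (γ + 1) ⊕ Fin m => Phase d).symm q) with hZ
        have hl (a) : Z (e (Sum.inl a)) = q.1 a := by
          rw [hZ, MeasurableEquiv.coe_piCongrLeft, Equiv.piCongrLeft_apply_apply]
          rfl
        have hr (i) : Z (e (Sum.inr i)) = q.2 i := by
          rw [hZ, MeasurableEquiv.coe_piCongrLeft, Equiv.piCongrLeft_apply_apply]
          rfl
        have hprod : ∏ i, phaseWeight d (Z i) =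
            (∏ a, phaseWeight d (q.1 a)) * ∏ i, phaseWeight d (q.2 i) := by
          rw [← e.prod_comp, Fintype.prod_sum_type]
          simp_rw [hl, hr]
        have hcore : HardCore d ε Z → HardCore d ε q.2 := fun h i j hij => by
          simpa only [hr] using h (e (Sum.inr i)) (e (Sum.inr j)) (by simpa using hij)
        simp_rw [← he, hl, hprod]
        by_cases h1 : HardCore d ε Z
        · simp only [G, H, if_pos h1, if_pos (hcore h1), one_mul, mul_assoc, le_refl]
        · simp [h1]
    _ = (∫⁻ X, G X) * hsMass d ε m := by
        rw [Measure.volume_eq_prod, lintegral_prod_mul hG.aemeasurable hH.aemeasurable]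
        rfl
    _ ≤ _ := by
        gcongr
        exact lintegral_near_zero_le γ hρ

/-- The contribution of the `N`-particle sector to the unnormalised cluster probability. -/
def clusterMass (d γ : ℕ) (ε r : ℝ) (N : ℕ) : ℝ≥0∞ :=
  ∫⁻ Z : Fin N → Phase d,
    (if HardCore d ε Z then (1 : ℝ≥0∞) else 0) *
      (if ∃ f : Fin (γ + 1) ↪ Fin N,
          (SimpleGraph.fromRel fun a b =>
              torusDist (Z (f a)).1 (Z (f b)).1 ≤ r).Connected
        then (1 : ℝ≥0∞) else 0) *
      ENNReal.ofReal (∏ i, maxwellian d (Z i).2)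

theorem clusterMass_eq_zero {d γ : ℕ} (ε r : ℝ) {N : ℕ} (hN : N < γ + 1) :
    clusterMass d γ ε r N = 0 := by
  have : IsEmpty (Fin (γ + 1) ↪ Fin N) := ⟨fun f => by
    have := Fintype.card_le_of_embedding f
    simp only [Fintype.card_fin] at this
    omega⟩
  simp [clusterMass]

theorem clusterMass_le {d γ : ℕ} (ε : ℝ) {r : ℝ} (hr : 0 ≤ r) (m : ℕ) :
    clusterMass d γ ε r (m + (γ + 1)) ≤ ((m + (γ + 1)).descFactorial (γ + 1) : ℝ≥0∞) *
      (ENNReal.ofReal ((2 * (γ * r)) ^ (d * γ)) * hsMass d ε m) := by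
  calc clusterMass d γ ε r (m + (γ + 1))
      ≤ ∫⁻ Z : Fin (m + (γ + 1)) → Phase d, ∑ f : Fin (γ + 1) ↪ Fin (m + (γ + 1)),
        (if HardCore d ε Z then (1 : ℝ≥0∞) else 0) *
          (if ∀ a, torusDist (Z (f a)).1 (Z (f 0)).1 ≤ γ * r then (1 : ℝ≥0∞) else 0) *
          ∏ i, phaseWeight d (Z i) := by
        refine lintegral_mono fun Z => ?_
        simp only [ofReal_prod_maxwellian]
        split_ifs with h1 h2
        · obtain ⟨f, hf⟩ := h2
          refine le_trans ?_ (Finset.single_le_sum (fun _ _ => zero_le) (Finset.mem_univ f))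
          rw [if_pos]
          exact fun a => torusDist_le_of_connected (fun a => (Z (f a)).1) hr hf a 0
        all_goals simp
    _ = ∑ f : Fin (γ + 1) ↪ Fin (m + (γ + 1)), ∫⁻ Z : Fin (m + (γ + 1)) → Phase d,
        (if HardCore d ε Z then (1 : ℝ≥0∞) else 0) *
          (if ∀ a, torusDist (Z (f a)).1 (Z (f 0)).1 ≤ γ * r then (1 : ℝ≥0∞) else 0) *
          ∏ i, phaseWeight d (Z i) := by
        refine lintegral_finsetSum _ fun f _ => ?_
        have := (measurable_near_zero_indicator d γ (γ * r)).comp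
          (measurable_pi_lambda (fun (Z : Fin (m + (γ + 1)) → Phase d) a => Z (f a))
            fun a => measurable_pi_apply _)
        exact ((measurable_hardCore_indicator d ε _).mul this).mul (by fun_prop)
    _ ≤ ∑ _f : Fin (γ + 1) ↪ Fin (m + (γ + 1)),
        ENNReal.ofReal ((2 * (γ * r)) ^ (d * γ)) * hsMass d ε m :=
        Finset.sum_le_sum fun f _ => lintegral_near_selected_le ε (by positivity) f
    _ = _ := by
        rw [Finset.sum_const, Finset.card_univ, Fintype.card_embedding_eq, Fintype.card_fin,
          Fintype.card_fin, nsmul_eq_mul]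

theorem pow_div_factorial_mul_descFactorial (x : ℝ) (m k : ℕ) :
    x ^ (m + k) / (m + k).factorial * (m + k).descFactorial k =
      x ^ k * (x ^ m / m.factorial) := by
  have h := Nat.factorial_mul_descFactorial (Nat.le_add_left k m)
  rw [Nat.add_sub_cancel] at h
  have h' : ((m + k).factorial : ℝ) = m.factorial * (m + k).descFactorial k := by exact_mod_cast h.symm
  have h0 : ((m + k).factorial : ℝ) ≠ 0 := by positivity
  have h1 : (m.factorial : ℝ) ≠ 0 := by positivity
  field_simp
  rw [h', pow_add]
  ring

/-- The static cluster estimate from the proof of Proposition 2.1: the probability,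
under the grand canonical hard-sphere Gibbs measure, that the configuration contains
`γ+1` distinct particles whose `r`-proximity graph (an edge whenever the torus
distance of the positions is at most `r`) is connected, is at most
`C μ_ε^{γ+1} r^{dγ}`, with `C` depending only on `d` and `γ`. -/
theorem stmt_17 (d γ : ℕ) (hd : 2 ≤ d) (hγ : 1 ≤ γ) :
    ∃ C : ℝ, 0 < C ∧
      ∀ ε : ℝ, 0 < ε → ε < 1 → ∀ r : ℝ, 0 < r →
        (∑' N : ℕ,
            ENNReal.ofReal (mu d ε ^ N / N.factorial) *
              ∫⁻ Z : Fin N → Phase d,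
                (if HardCore d ε Z then (1 : ℝ≥0∞) else 0) *
                  (if ∃ f : Fin (γ + 1) ↪ Fin N,
                      (SimpleGraph.fromRel fun a b =>
                          torusDist (Z (f a)).1 (Z (f b)).1 ≤ r).Connected
                    then (1 : ℝ≥0∞) else 0) *
                  ENNReal.ofReal (∏ i, maxwellian d (Z i).2)) /
          ENNReal.ofReal (partitionFn d ε)
          ≤ ENNReal.ofReal (C * mu d ε ^ (γ + 1) * r ^ (d * γ)) := by
  refine ⟨(2 * γ) ^ (d * γ), by positivity, fun ε hε _ r hr => ?_⟩
  have hmu := mu_pos d hε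
  refine ENNReal.div_le_of_le_mul ?_
  rw [ofReal_partitionFn d hε, ← ENNReal.tsum_mul_left]
  change ∑' N : ℕ, ENNReal.ofReal (mu d ε ^ N / N.factorial) * clusterMass d γ ε r N ≤ _
  rw [← ENNReal.summable.sum_add_tsum_nat_add' (k := γ + 1), Finset.sum_eq_zero fun N hN => by
    rw [clusterMass_eq_zero ε r (Finset.mem_range.1 hN), mul_zero], zero_add]
  refine ENNReal.tsum_le_tsum fun m => ?_
  calc _ ≤ ENNReal.ofReal (mu d ε ^ (m + (γ + 1)) / (m + (γ + 1)).factorial) *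
        (((m + (γ + 1)).descFactorial (γ + 1) : ℝ≥0∞) *
          (ENNReal.ofReal ((2 * (γ * r)) ^ (d * γ)) * hsMass d ε m)) := by
        gcongr
        exact clusterMass_le ε hr.le m
    _ = _ := by
        rw [← mul_assoc, ← mul_assoc, ← mul_assoc, ← ENNReal.ofReal_natCast,
          ← ENNReal.ofReal_mul (by positivity), ← ENNReal.ofReal_mul (by positivity),
          pow_div_factorial_mul_descFactorial, ← mul_assoc (ENNReal.ofReal _),
          ← ENNReal.ofReal_mul (by positivity)]
        congr 2
        rw [mul_pow]
        ring
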